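/- Let r_0 = r_0(n) be defined by C(n,r)·d^{C(r,2)} = 1 with b = 1/d > 1. Then r_0(n) = 2log_b n - 2log_b log_b n + 2log_b(e/2) + 1 + o(1) as n → ∞; in particular r_0(n)/(2 log_b n) → 1 as n → ∞. -/

import Mathlib

open Real Filter

/-- Chord bounds for `log Γ`: the increment over `[n - r + 1, n + 1]` lies between
`r log (n - r)` and `r log n`. -/
lemma log_Gamma_add_one_sub_le {n r : ℝ} (hr : 1 < r) (hrn : r ≤ n) :
    log (Gamma (n + 1)) - log (Gamma (n - r + 1)) ≤ r * log n := by
  have hn : 0 < n := by linarith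
  have h := convexOn_log_Gamma.secant_mono_aux3 (x := n - r + 1) (y := n) (z := n + 1)
    (by simp; linarith) (by simp; linarith) (by linarith) (by linarith)
  have hG : log (Gamma (n + 1)) = log n + log (Gamma n) := by
    rw [Gamma_add_one hn.ne', log_mul hn.ne' (Gamma_pos_of_pos hn).ne']
  simp only [Function.comp_apply] at h
  rw [show n + 1 - (n - r + 1) = r by ring, show n + 1 - n = 1 by ring, div_one,
    div_le_iff₀ (by linarith)] at h
  rw [hG] at h ⊢
  linarith

lemma le_log_Gamma_add_one_sub {n r : ℝ} (hr : 0 < r) (hrn : r < n) :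
    r * log (n - r) ≤ log (Gamma (n + 1)) - log (Gamma (n - r + 1)) := by
  have hn : 0 < n - r := by linarith
  have h := convexOn_log_Gamma.slope_mono_adjacent (x := n - r) (y := n - r + 1) (z := n + 1)
    (by simpa using hrn) (by simp; linarith) (by linarith) (by linarith)
  have hG : log (Gamma (n - r + 1)) = log (n - r) + log (Gamma (n - r)) := by
    rw [Gamma_add_one hn.ne', log_mul hn.ne' (Gamma_pos_of_pos hn).ne']
  simp only [Function.comp_apply] at h
  rw [show n + 1 - (n - r + 1) = r by ring, show n - r + 1 - (n - r) = 1 by ring, div_one,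
    le_div_iff₀ hr] at h
  have : log (Gamma (n - r + 1)) - log (Gamma (n - r)) = log (n - r) := by linarith
  rw [this] at h
  linarith

/-- A crude Stirling lower bound for the Gamma function at real arguments. -/
lemma le_log_Gamma_add_one {x : ℝ} (hx : 1 ≤ x) :
    x * log x - x - log x ≤ log (Gamma (x + 1)) := by
  set m := ⌊x⌋₊
  have hm1 : 1 ≤ m := Nat.le_floor (by simpa using hx)
  have hm1' : (1 : ℝ) ≤ m := by exact_mod_cast hm1
  have hmx : (m : ℝ) ≤ x := Nat.floor_le (by linarith)
  have hxm : x < m + 1 := Nat.lt_floor_add_one x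
  have hx0 : 0 < x := by linarith
  have hm0 : (0 : ℝ) < m := by linarith
  have hfac : log (m.factorial : ℝ) ≤ log (Gamma (x + 1)) := by
    rw [← Gamma_nat_eq_factorial]
    exact log_le_log (Gamma_pos_of_pos (by linarith))
      (Gamma_strictMonoOn_Ici.monotoneOn (by simp; linarith) (by simp; linarith) (by linarith))
  have hst := Stirling.le_log_factorial_stirling (n := m) (by omega)
  have hpi : 0 ≤ log (2 * π) := log_nonneg (by nlinarith [pi_gt_three])
  have hlm : 0 ≤ log (m : ℝ) := log_nonneg hm1'
  have hlx : 0 ≤ log x := log_nonneg hx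
  have hlog : log x - log m ≤ x / m - 1 := by
    rw [← log_div hx0.ne' hm0.ne']
    exact log_le_sub_one_of_pos (by positivity)
  have hmul : m * (log x - log m) ≤ x - m := by
    calc m * (log x - log m) ≤ m * (x / m - 1) := by gcongr
      _ = x - m := by field_simp
  nlinarith

/-- A crude Stirling upper bound for the Gamma function at real arguments. -/
lemma log_Gamma_add_one_le {x : ℝ} (hx : 1 ≤ x) :
    log (Gamma (x + 1)) ≤ x * log x - x + 2 * log x + 5 := by
  set m := ⌊x⌋₊
  have hm1 : 1 ≤ m := Nat.le_floor (by simpa using hx)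
  have hm1' : (1 : ℝ) ≤ m := by exact_mod_cast hm1
  have hmx : (m : ℝ) ≤ x := Nat.floor_le (by linarith)
  have hxm : x < m + 1 := Nat.lt_floor_add_one x
  have hx0 : 0 < x := by linarith
  have hM0 : (0 : ℝ) < m + 1 := by linarith
  have hlx : 0 ≤ log x := log_nonneg hx
  have hfac : log (Gamma (x + 1)) ≤ log ((m + 1).factorial : ℝ) := by
    rw [← Gamma_nat_eq_factorial]
    push_cast
    exact log_le_log (Gamma_pos_of_pos (by linarith))
      (Gamma_strictMonoOn_Ici.monotoneOn (by simp; linarith) (by simp; linarith) (by linarith))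
  have hst := Stirling.log_stirlingSeq_formula (m + 1)
  have hanti : log (Stirling.stirlingSeq (m + 1)) ≤ log (Stirling.stirlingSeq 1) :=
    Stirling.log_stirlingSeq'_antitone (Nat.zero_le m)
  have hone : log (Stirling.stirlingSeq 1) ≤ 1 := by
    rw [Stirling.stirlingSeq_one, log_div (exp_pos _).ne' (by positivity), log_exp]
    have : 0 ≤ log (√2) := log_nonneg (by simp)
    linarith
  rw [log_div (by positivity) (exp_pos _).ne', log_exp] at hst
  push_cast at hst
  have hlog : log (m + 1) - log x ≤ (m + 1) / x - 1 := by
    rw [← log_div hM0.ne' hx0.ne']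
    exact log_le_sub_one_of_pos (by positivity)
  have hbd : ((m : ℝ) + 1) / x - 1 ≤ 1 / x := by
    rw [div_sub_one hx0.ne']
    gcongr
    linarith
  have hinv : 1 / x ≤ 1 := by rw [div_le_one hx0]; exact hx
  have hmul : (m + 1) * (log (m + 1) - log x) ≤ 2 := by
    calc (m + 1) * (log (m + 1) - log x) ≤ (x + 1) * (1 / x) := by
          refine (mul_le_mul_of_nonneg_left (hlog.trans hbd) hM0.le).trans ?_
          gcongr
      _ = 1 + 1 / x := by field_simp
      _ ≤ 2 := by linarith
  have hlogM : log (2 * ((m : ℝ) + 1)) ≤ 2 * log x + 2 := by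
    rw [log_mul (by norm_num) hM0.ne']
    linarith [log_two_lt_d9]
  nlinarith

lemma tendsto_log_div_self_atTop : Tendsto (fun x : ℝ => log x / x) atTop (nhds 0) := by
  simpa using tendsto_pow_log_div_mul_add_atTop 1 0 1 one_ne_zero

/-- Weak Stirling formula for the Gamma function. -/
lemma tendsto_log_Gamma_add_one_div_sub_log :
    Tendsto (fun x : ℝ => log (Gamma (x + 1)) / x - log x) atTop (nhds (-1)) := by
  have hinv : Tendsto (fun x : ℝ => 1 / x) atTop (nhds 0) := by
    simpa using tendsto_inv_atTop_zero
  have hlow : Tendsto (fun x : ℝ => -1 - log x / x) atTop (nhds (-1)) := by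
    simpa using tendsto_log_div_self_atTop.const_sub (-1)
  have hupp : Tendsto (fun x : ℝ => -1 + 2 * (log x / x) + 5 * (1 / x)) atTop (nhds (-1)) := by
    simpa using ((tendsto_log_div_self_atTop.const_mul 2).const_add (-1)).add (hinv.const_mul 5)
  refine tendsto_of_tendsto_of_tendsto_of_le_of_le' hlow hupp ?_ ?_
  · filter_upwards [eventually_ge_atTop 1] with x hx
    have hx0 : 0 < x := by linarith
    calc -1 - log x / x = (x * log x - x - log x) / x - log x := by field_simp; ring
      _ ≤ _ := by gcongr; exact le_log_Gamma_add_one hx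
  · filter_upwards [eventually_ge_atTop 1] with x hx
    have hx0 : 0 < x := by linarith
    calc log (Gamma (x + 1)) / x - log x
        ≤ (x * log x - x + 2 * log x + 5) / x - log x := by
          gcongr; exact log_Gamma_add_one_le hx
      _ = _ := by field_simp; ring

/-- If `r = 2ℓ - c log r + O(1)` and `r → ∞`, then `r ~ 2ℓ`. -/
lemma tendsto_div_of_tendsto_sub_add_log {α : Type*} {F : Filter α} {r l : α → ℝ} {c a : ℝ}
    (hr : Tendsto r F atTop)
    (h : Tendsto (fun n => r n - 2 * l n + c * log (r n)) F (nhds a)) :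
    Tendsto (fun n => r n / l n) F (nhds 2) := by
  have hlog := tendsto_log_div_self_atTop.comp hr
  have h1 : Tendsto (fun n => (1 + c * (log (r n) / r n)
      - (r n - 2 * l n + c * log (r n)) / r n) / 2) F (nhds ((1 + c * 0 - 0) / 2)) :=
    (((hlog.const_mul c).const_add 1).sub (h.div_atTop hr)).div_const 2
  have h2 : Tendsto (fun n => l n / r n) F (nhds (1 / 2)) := by
    refine Tendsto.congr' ?_ (by simpa using h1)
    filter_upwards [hr.eventually_gt_atTop 0] with n hn
    field_simp
    ring
  simpa using h2.inv₀ (by norm_num)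

/-- The logarithm of the equation `C(n,r) d ^ C(r,2) = 1`. -/
lemma log_Gamma_binomial_eq {d n r : ℝ} (hd : 0 < d) (hr : 0 ≤ r) (hrn : r ≤ n)
    (h : Gamma (n + 1) / (Gamma (r + 1) * Gamma (n - r + 1)) * d ^ (r * (r - 1) / 2) = 1) :
    log (Gamma (n + 1)) - log (Gamma (n - r + 1))
      = log (Gamma (r + 1)) - r * (r - 1) / 2 * log d := by
  have h1 := (Gamma_pos_of_pos (show 0 < n + 1 by linarith)).ne'
  have h2 := (Gamma_pos_of_pos (show 0 < r + 1 by linarith)).ne'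
  have h3 := (Gamma_pos_of_pos (show 0 < n - r + 1 by linarith)).ne'
  have := congrArg log h
  rw [log_mul (by positivity) (rpow_pos_of_pos hd _).ne', log_div h1 (by positivity),
    log_mul h2 h3, log_rpow hd, log_one] at this
  linarith

/-- Let `d ∈ (0,1)`, `b = 1/d > 1`, and let `r₀(n)` be the (large) real solution of the
Stirling-interpolated equation `C(n,r)·d^{C(r,2)} = 1` (binomial coefficient interpolated
via the Gamma function), normalized by `log_b n ≤ r₀(n) ≤ n`.  Then
`r₀(n) = 2 log_b n - 2 log_b log_b n + 2 log_b (e/2) + 1 + o(1)`; in particular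
`r₀(n)/(2 log_b n) → 1` as `n → ∞`. -/
theorem stmt_17 (d b : ℝ) (hd0 : 0 < d) (hd1 : d < 1) (hb : b = 1 / d)
    (r0 : ℕ → ℝ)
    (hroot : ∀ n : ℕ, 2 ≤ n →
      Real.logb b n ≤ r0 n ∧ r0 n ≤ n ∧
        Real.Gamma ((n : ℝ) + 1) /
            (Real.Gamma (r0 n + 1) * Real.Gamma ((n : ℝ) - r0 n + 1)) *
          Real.rpow d (r0 n * (r0 n - 1) / 2) = 1) :
    Tendsto (fun n : ℕ => r0 n -
        (2 * Real.logb b n - 2 * Real.logb b (Real.logb b n)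
          + 2 * Real.logb b (Real.exp 1 / 2) + 1)) atTop (nhds 0) ∧
    Tendsto (fun n : ℕ => r0 n / (2 * Real.logb b n)) atTop (nhds 1) := by
  have hb1 : 1 < b := by rw [hb]; exact one_lt_one_div hd0 hd1
  set L := log b with hL
  have hLpos : 0 < L := log_pos hb1
  have hlogd : log d = -L := by rw [hL, hb, one_div, log_inv, neg_neg]
  have hcast : Tendsto (fun n : ℕ => (n : ℝ)) atTop atTop := tendsto_natCast_atTop_atTop
  have hl : Tendsto (fun n : ℕ => logb b n) atTop atTop := (tendsto_logb_atTop hb1).comp hcast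
  have hr : Tendsto r0 atTop atTop := by
    refine tendsto_atTop_mono' _ ?_ hl
    filter_upwards [eventually_ge_atTop 2] with n hn using (hroot n hn).1
  have heq : ∀ᶠ n : ℕ in atTop, log (Gamma ((n : ℝ) + 1)) - log (Gamma ((n : ℝ) - r0 n + 1))
      = log (Gamma (r0 n + 1)) + r0 n * (r0 n - 1) / 2 * L := by
    filter_upwards [eventually_ge_atTop 2, hr.eventually_ge_atTop 0] with n hn hr0
    rw [log_Gamma_binomial_eq hd0 hr0 (hroot n hn).2.1 (hroot n hn).2.2, hlogd]
    ring
  have hupper : ∀ᶠ n : ℕ in atTop, r0 n ≤ 2 / L * log n + 1 := by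
    filter_upwards [eventually_ge_atTop 2, hr.eventually_gt_atTop 1, heq] with n hn hr1 he
    have h1 := log_Gamma_add_one_sub_le hr1 (hroot n hn).2.1
    have h2 : 0 ≤ log (Gamma (r0 n + 1)) := by
      have hG : Gamma 2 ≤ Gamma (r0 n + 1) := Gamma_strictMonoOn_Ici.monotoneOn (by simp)
        (by simp; linarith) (by linarith)
      exact log_nonneg (by rwa [Gamma_two] at hG)
    have h3 : r0 n * ((r0 n - 1) / 2 * L) ≤ r0 n * log n := by linarith
    have h4 := le_of_mul_le_mul_left h3 (by linarith)
    have h5 : r0 n - 1 ≤ log n * 2 / L := by rw [le_div_iff₀ hLpos]; linarith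
    linarith [show log (n : ℝ) * 2 / L = 2 / L * log n by ring]
  have hrn : Tendsto (fun n : ℕ => r0 n / n) atTop (nhds 0) := by
    have hup : Tendsto (fun n : ℕ => 2 / L * (log n / n) + 1 / n) atTop (nhds 0) := by
      simpa using ((tendsto_log_div_self_atTop.comp hcast).const_mul (2 / L)).add
        (tendsto_const_nhds (x := (1 : ℝ)).div_atTop hcast)
    refine tendsto_of_tendsto_of_tendsto_of_le_of_le' tendsto_const_nhds hup ?_ ?_
    · filter_upwards [hr.eventually_ge_atTop 0] with n hn
      positivity
    · filter_upwards [hupper] with n hn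
      calc r0 n / n ≤ (2 / L * log n + 1) / n := by gcongr
        _ = _ := by ring
  have hfall : Tendsto (fun n : ℕ => (log (Gamma ((n : ℝ) + 1))
      - log (Gamma ((n : ℝ) - r0 n + 1))) / r0 n - log n) atTop (nhds 0) := by
    have hlow : Tendsto (fun n : ℕ => log (1 - r0 n / n)) atTop (nhds 0) := by
      have := (hrn.const_sub 1).log (by norm_num)
      simpa using this
    refine tendsto_of_tendsto_of_tendsto_of_le_of_le' hlow tendsto_const_nhds ?_ ?_
    · filter_upwards [eventually_ge_atTop 2, hr.eventually_gt_atTop 0,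
        hrn.eventually_lt_const one_pos] with n hn hr0 hlt
      have hn0 : (0 : ℝ) < n := by positivity
      rw [div_lt_one hn0] at hlt
      rw [one_sub_div hn0.ne', log_div (by linarith) hn0.ne']
      gcongr
      rw [le_div_iff₀ hr0, mul_comm]
      exact le_log_Gamma_add_one_sub hr0 hlt
    · filter_upwards [eventually_ge_atTop 2, hr.eventually_gt_atTop 1] with n hn hr1
      rw [sub_nonpos, div_le_iff₀ (by linarith), mul_comm]
      exact log_Gamma_add_one_sub_le hr1 (hroot n hn).2.1
  have hmain : Tendsto (fun n => r0 n - 2 * logb b n + 2 / L * log (r0 n)) atTop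
      (nhds (1 + 2 / L)) := by
    have h := (((hfall.sub (tendsto_log_Gamma_add_one_div_sub_log.comp hr)).const_mul
      (2 / L)).const_add 1)
    refine Tendsto.congr' ?_ (by simpa using h)
    filter_upwards [hr.eventually_gt_atTop 0, heq] with n hr0 he
    simp only [logb, ← hL]
    rw [he]
    field_simp
    ring
  have hratio := tendsto_div_of_tendsto_sub_add_log hr hmain
  refine ⟨?_, ?_⟩
  · have hlog := hratio.log two_ne_zero
    have h := (hmain.sub (hlog.const_mul (2 / L))).sub_const (1 + 2 / L - 2 / L * log 2)
    refine Tendsto.congr' ?_ (by simpa using h)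
    filter_upwards [hr.eventually_gt_atTop 0, hl.eventually_gt_atTop 0] with n hr0 hl0
    rw [log_div hr0.ne' hl0.ne', logb, logb, logb, log_div (exp_pos _).ne' two_ne_zero, log_exp,
      ← hL]
    field_simp
    ring
  · refine Tendsto.congr (fun n => ?_) (by simpa using hratio.div_const 2)
    rw [div_div, mul_comm]
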